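/- Let t be a plain term of λFv with Γ;Δ ⊢ t : S, where Γ = x1:T1,…,xn:Tn and Δ = k1:¬U1,…,km:¬Um. Let {α1,…,αp} = ftv(S) ∪ ftv(Γ) ∪ ftv(Δ), let V̄ be a sequence of p types, and let R̄ be reducibility candidates with R_i ∈ RC(V_i) for i = 1,…,p. Let v̄ be closed values with ⊢ v_i : T_i[ᾱ:=V̄] and v_i ∈ RED_{T_i}(ᾱ↦R̄) for i = 1,…,n. Let Ē be closed contexts with ⊢ E_i : ¬U_i and RED_{U_i}(ᾱ↦R̄) ⊨ E_i for i = 1,…,m, and let E be a closed context with ⊢ E : ¬S and RED_S(ᾱ↦R̄) ⊨ E. Then norm(E[t[ᾱ:=V̄][x̄:=v̄][k̄:=⌈Ē⌉]]) holds. -/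

import Mathlib

/-!
Language `λFv`: explicitly typed System F extended with the abortive control
operator `callcc` and a `throw` construct, in de Bruijn representation
(separate de Bruijn indices for term variables, continuation variables and
type variables).
-/

namespace LambdaFv

/-- Types of System F: type variables (de Bruijn), arrow types, universal types. -/
inductive Ty : Type where
  | var : Nat → Ty
  | arrow : Ty → Ty → Ty
  | all : Ty → Ty

/-- Lifting of a renaming under a binder. -/
def liftRen (ρ : Nat → Nat) : Nat → Nat
  | 0 => 0
  | n+1 => ρ n + 1

/-- Renaming of type variables in a type. -/
def renTy (ρ : Nat → Nat) : Ty → Ty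
  | .var n => .var (ρ n)
  | .arrow a b => .arrow (renTy ρ a) (renTy ρ b)
  | .all a => .all (renTy (liftRen ρ) a)

/-- Lifting of a type substitution under a type binder. -/
def liftTySub (σ : Nat → Ty) : Nat → Ty
  | 0 => .var 0
  | n+1 => renTy Nat.succ (σ n)

/-- Simultaneous substitution of types for type variables in a type. -/
def subTy (σ : Nat → Ty) : Ty → Ty
  | .var n => σ n
  | .arrow a b => .arrow (subTy σ a) (subTy σ b)
  | .all a => .all (subTy (liftTySub σ) a)

/-- `subTy0 U S` is `S[α₀ := U]` (instantiation of the type variable 0). -/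
def subTy0 (U : Ty) (S : Ty) : Ty :=
  subTy (fun n => match n with | 0 => U | n+1 => .var n) S

/-- `subTyList Ts S` is `S[ᾱ := Ts]`: simultaneous substitution of the types
`Ts` for the free type variables of `S`. -/
def subTyList (Ts : List Ty) (S : Ty) : Ty :=
  subTy (fun n => Ts.getD n (.var n)) S

/-- `ScopedTy p S`: all free type variables of `S` are among `α₀,…,α_{p-1}`. -/
inductive ScopedTy : Nat → Ty → Prop where
  | var : ∀ {p n}, n < p → ScopedTy p (.var n)
  | arrow : ∀ {p a b}, ScopedTy p a → ScopedTy p b → ScopedTy p (.arrow a b)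
  | all : ∀ {p a}, ScopedTy (p+1) a → ScopedTy p (.all a)

/-- A closed type: no free type variables. -/
def ClosedTy (S : Ty) : Prop := ScopedTy 0 S

mutual
/-- Terms of `λFv`:
variables, `λx:S.t`, application, `Λα.t`, type application, `K k.t` (callcc),
`k ← t` (throw to a continuation variable), `⌈E⌉ ← t` (throw to a reified context). -/
inductive Tm : Type where
  | var : Nat → Tm
  | lam : Ty → Tm → Tm
  | app : Tm → Tm → Tm
  | tlam : Tm → Tm
  | tapp : Tm → Ty → Tm
  | callcc : Tm → Tm
  | throwVar : Nat → Tm → Tm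
  | throwCtx : Ctx → Tm → Tm

/-- Call-by-value evaluation contexts, represented inside-out:
`[]`, `(λx:S.t)·E`, `E t`, `E S`, `⌈E₀⌉ ← E`. -/
inductive Ctx : Type where
  | hole : Ctx
  | lamApp : Ty → Tm → Ctx → Ctx
  | app : Ctx → Tm → Ctx
  | tapp : Ctx → Ty → Ctx
  | throw : Ctx → Ctx → Ctx
end

/-- Plugging a term in a context (contexts are represented inside-out). -/
def plug : Tm → Ctx → Tm
  | t, .hole => t
  | t, .lamApp S b E => plug (.app (.lam S b) t) E
  | t, .app E u => plug (.app t u) E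
  | t, .tapp E S => plug (.tapp t S) E
  | t, .throw E0 E => plug (.throwCtx E0 t) E

/-- Values: λ-abstractions and Λ-abstractions. -/
inductive IsValue : Tm → Prop where
  | lam : ∀ {S t}, IsValue (.lam S t)
  | tlam : ∀ {t}, IsValue (.tlam t)

/-- Plain terms: terms with no subterm of the form `⌈E⌉ ← t`. -/
inductive Plain : Tm → Prop where
  | var : ∀ {n}, Plain (.var n)
  | lam : ∀ {S t}, Plain t → Plain (.lam S t)
  | app : ∀ {a b}, Plain a → Plain b → Plain (.app a b)
  | tlam : ∀ {t}, Plain t → Plain (.tlam t)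
  | tapp : ∀ {t S}, Plain t → Plain (.tapp t S)
  | callcc : ∀ {t}, Plain t → Plain (.callcc t)
  | throwVar : ∀ {k t}, Plain t → Plain (.throwVar k t)

mutual
/-- `ScTm n m p t`: the free term variables of `t` are `< n`, its free
continuation variables are `< m` and its free type variables are `< p`. -/
inductive ScTm : Nat → Nat → Nat → Tm → Prop where
  | var : ∀ {n m p x}, x < n → ScTm n m p (.var x)
  | lam : ∀ {n m p S t}, ScopedTy p S → ScTm (n+1) m p t → ScTm n m p (.lam S t)
  | app : ∀ {n m p a b}, ScTm n m p a → ScTm n m p b → ScTm n m p (.app a b)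
  | tlam : ∀ {n m p t}, ScTm n m (p+1) t → ScTm n m p (.tlam t)
  | tapp : ∀ {n m p t S}, ScTm n m p t → ScopedTy p S → ScTm n m p (.tapp t S)
  | callcc : ∀ {n m p t}, ScTm n (m+1) p t → ScTm n m p (.callcc t)
  | throwVar : ∀ {n m p k t}, k < m → ScTm n m p t → ScTm n m p (.throwVar k t)
  | throwCtx : ∀ {n m p E t}, ScCtx n m p E → ScTm n m p t → ScTm n m p (.throwCtx E t)

/-- Scoping predicate for contexts. -/
inductive ScCtx : Nat → Nat → Nat → Ctx → Prop where
  | hole : ∀ {n m p}, ScCtx n m p .hole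
  | lamApp : ∀ {n m p S t E}, ScopedTy p S → ScTm (n+1) m p t → ScCtx n m p E →
      ScCtx n m p (.lamApp S t E)
  | app : ∀ {n m p E t}, ScCtx n m p E → ScTm n m p t → ScCtx n m p (.app E t)
  | tapp : ∀ {n m p E S}, ScCtx n m p E → ScopedTy p S → ScCtx n m p (.tapp E S)
  | throw : ∀ {n m p E0 E1}, ScCtx n m p E0 → ScCtx n m p E1 → ScCtx n m p (.throw E0 E1)
end

/-- A closed term: no free variables of any kind. -/
def ClosedTm (t : Tm) : Prop := ScTm 0 0 0 t

/-- A closed context: no free variables of any kind. -/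
def ClosedCtx (E : Ctx) : Prop := ScCtx 0 0 0 E

mutual
/-- Renaming of the three kinds of variables in terms. -/
def renTm (ρx ρk ρa : Nat → Nat) : Tm → Tm
  | .var n => .var (ρx n)
  | .lam S t => .lam (renTy ρa S) (renTm (liftRen ρx) ρk ρa t)
  | .app a b => .app (renTm ρx ρk ρa a) (renTm ρx ρk ρa b)
  | .tlam t => .tlam (renTm ρx ρk (liftRen ρa) t)
  | .tapp t S => .tapp (renTm ρx ρk ρa t) (renTy ρa S)
  | .callcc t => .callcc (renTm ρx (liftRen ρk) ρa t)
  | .throwVar k t => .throwVar (ρk k) (renTm ρx ρk ρa t)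
  | .throwCtx E t => .throwCtx (renCtx ρx ρk ρa E) (renTm ρx ρk ρa t)

/-- Renaming of the three kinds of variables in contexts. -/
def renCtx (ρx ρk ρa : Nat → Nat) : Ctx → Ctx
  | .hole => .hole
  | .lamApp S t E => .lamApp (renTy ρa S) (renTm (liftRen ρx) ρk ρa t) (renCtx ρx ρk ρa E)
  | .app E t => .app (renCtx ρx ρk ρa E) (renTm ρx ρk ρa t)
  | .tapp E S => .tapp (renCtx ρx ρk ρa E) (renTy ρa S)
  | .throw E0 E => .throw (renCtx ρx ρk ρa E0) (renCtx ρx ρk ρa E)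
end

/-- An entry of a continuation substitution: either a reified context or a
continuation variable. -/
def mapKEnt (f : Ctx → Ctx) : Ctx ⊕ Nat → Ctx ⊕ Nat
  | .inl E => .inl (f E)
  | .inr n => .inr n

/-- Lifting of a term substitution under a term binder. -/
def liftSubX (σ : Nat → Tm) : Nat → Tm
  | 0 => .var 0
  | n+1 => renTm Nat.succ id id (σ n)

/-- Shifting of a term substitution under a continuation binder. -/
def shiftSubXk (σ : Nat → Tm) : Nat → Tm := fun n => renTm id Nat.succ id (σ n)

/-- Shifting of a term substitution under a type binder. -/
def shiftSubXa (σ : Nat → Tm) : Nat → Tm := fun n => renTm id id Nat.succ (σ n)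

/-- Lifting of a continuation substitution under a continuation binder. -/
def liftSubK (σ : Nat → Ctx ⊕ Nat) : Nat → Ctx ⊕ Nat
  | 0 => .inr 0
  | n+1 =>
    match σ n with
    | .inl E => .inl (renCtx id Nat.succ id E)
    | .inr m => .inr (m+1)

/-- Shifting of a continuation substitution under a term binder. -/
def shiftSubKx (σ : Nat → Ctx ⊕ Nat) : Nat → Ctx ⊕ Nat :=
  fun n => mapKEnt (renCtx Nat.succ id id) (σ n)

/-- Shifting of a continuation substitution under a type binder. -/
def shiftSubKa (σ : Nat → Ctx ⊕ Nat) : Nat → Ctx ⊕ Nat :=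
  fun n => mapKEnt (renCtx id id Nat.succ) (σ n)

mutual
/-- Simultaneous capture-avoiding substitution in terms: `σx` substitutes terms for
term variables, `σk` substitutes reified contexts for continuation variables,
`σa` substitutes types for type variables. -/
def subTm (σx : Nat → Tm) (σk : Nat → Ctx ⊕ Nat) (σa : Nat → Ty) : Tm → Tm
  | .var n => σx n
  | .lam S t => .lam (subTy σa S) (subTm (liftSubX σx) (shiftSubKx σk) σa t)
  | .app a b => .app (subTm σx σk σa a) (subTm σx σk σa b)
  | .tlam t => .tlam (subTm (shiftSubXa σx) (shiftSubKa σk) (liftTySub σa) t)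
  | .tapp t S => .tapp (subTm σx σk σa t) (subTy σa S)
  | .callcc t => .callcc (subTm (shiftSubXk σx) (liftSubK σk) σa t)
  | .throwVar k t =>
    match σk k with
    | .inl E => .throwCtx E (subTm σx σk σa t)
    | .inr m => .throwVar m (subTm σx σk σa t)
  | .throwCtx E t => .throwCtx (subCtx σx σk σa E) (subTm σx σk σa t)

/-- Simultaneous capture-avoiding substitution in contexts. -/
def subCtx (σx : Nat → Tm) (σk : Nat → Ctx ⊕ Nat) (σa : Nat → Ty) : Ctx → Ctx
  | .hole => .hole
  | .lamApp S t E => .lamApp (subTy σa S) (subTm (liftSubX σx) (shiftSubKx σk) σa t) (subCtx σx σk σa E)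
  | .app E t => .app (subCtx σx σk σa E) (subTm σx σk σa t)
  | .tapp E S => .tapp (subCtx σx σk σa E) (subTy σa S)
  | .throw E0 E => .throw (subCtx σx σk σa E0) (subCtx σx σk σa E)
end

/-- `sub0X v t` is `t[x₀ := v]`. -/
def sub0X (v : Tm) (t : Tm) : Tm :=
  subTm (fun n => match n with | 0 => v | n+1 => .var n) Sum.inr Ty.var t

/-- `sub0A S t` is `t[α₀ := S]`. -/
def sub0A (S : Ty) (t : Tm) : Tm :=
  subTm Tm.var Sum.inr (fun n => match n with | 0 => S | n+1 => .var n) t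

/-- `sub0K E t` is `t[k₀ := ⌈E⌉]`. -/
def sub0K (E : Ctx) (t : Tm) : Tm :=
  subTm Tm.var (fun n => match n with | 0 => .inl E | n+1 => .inr n) Ty.var t

/-- `msub Vs vs Es t` is the simultaneous substitution
`t[ᾱ := Vs][x̄ := vs][k̄ := ⌈Es⌉]`. -/
def msub (Vs : List Ty) (vs : List Tm) (Es : List Ctx) (t : Tm) : Tm :=
  subTm (fun n => vs.getD n (.var n))
        (fun n => match Es[n]? with | some E => .inl E | none => .inr n)
        (fun n => Vs.getD n (.var n)) t

mutual
/-- The type system of Figure 1: typing of terms, `Γ;Δ ⊢ t : S`.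
`Γ` assigns types to term variables; `Δ` assigns context types `¬S`
(represented by their hole type `S`) to continuation variables. -/
inductive HasTy : List Ty → List Ty → Tm → Ty → Prop where
  | var : ∀ {Γ Δ x S}, Γ[x]? = some S → HasTy Γ Δ (.var x) S
  | lam : ∀ {Γ Δ S T t}, HasTy (S::Γ) Δ t T → HasTy Γ Δ (.lam S t) (.arrow S T)
  | app : ∀ {Γ Δ S T t0 t1}, HasTy Γ Δ t0 (.arrow S T) → HasTy Γ Δ t1 S →
      HasTy Γ Δ (.app t0 t1) T
  | tlam : ∀ {Γ Δ t S}, HasTy (Γ.map (renTy Nat.succ)) (Δ.map (renTy Nat.succ)) t S →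
      HasTy Γ Δ (.tlam t) (.all S)
  | tapp : ∀ {Γ Δ t S T}, HasTy Γ Δ t (.all S) → HasTy Γ Δ (.tapp t T) (subTy0 T S)
  | callcc : ∀ {Γ Δ t S}, HasTy Γ (S::Δ) t S → HasTy Γ Δ (.callcc t) S
  | throwVar : ∀ {Γ Δ k t S T}, Δ[k]? = some S → HasTy Γ Δ t S →
      HasTy Γ Δ (.throwVar k t) T
  | throwCtx : ∀ {Γ Δ E t S T}, HasTyCtx Γ Δ E S → HasTy Γ Δ t S →
      HasTy Γ Δ (.throwCtx E t) T

/-- The type system of Figure 1: typing of contexts, `Γ;Δ ⊢ E : ¬S`. -/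
inductive HasTyCtx : List Ty → List Ty → Ctx → Ty → Prop where
  | hole : ∀ {Γ Δ S}, HasTyCtx Γ Δ .hole S
  | lamApp : ∀ {Γ Δ S T t E}, HasTy Γ Δ (.lam S t) (.arrow S T) → HasTyCtx Γ Δ E T →
      HasTyCtx Γ Δ (.lamApp S t E) S
  | app : ∀ {Γ Δ S T t E}, HasTy Γ Δ t S → HasTyCtx Γ Δ E T →
      HasTyCtx Γ Δ (.app E t) (.arrow S T)
  | tapp : ∀ {Γ Δ S T E}, HasTyCtx Γ Δ E (subTy0 T S) → HasTyCtx Γ Δ (.tapp E T) (.all S)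
  | throw : ∀ {Γ Δ S T E0 E1}, HasTyCtx Γ Δ E0 S → HasTyCtx Γ Δ E1 T →
      HasTyCtx Γ Δ (.throw E0 E1) S
end

/-- The call-by-value one-step reduction relation `→v` of `λFv`. -/
inductive Step : Tm → Tm → Prop where
  | beta : ∀ {S t v E}, IsValue v →
      Step (plug (.app (.lam S t) v) E) (plug (sub0X v t) E)
  | betaT : ∀ {t S E},
      Step (plug (.tapp (.tlam t) S) E) (plug (sub0A S t) E)
  | callcc : ∀ {t E},
      Step (plug (.callcc t) E) (plug (sub0K E t) E)
  | throw : ∀ {E0 E1 v}, IsValue v →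
      Step (plug (.throwCtx E0 v) E1) (plug v E0)

/-- Call-by-value evaluation: the reflexive-transitive closure of `→v`. -/
def Steps : Tm → Tm → Prop := Relation.ReflTransGen Step

/-- Redexes of `λFv` under call by value. -/
inductive IsRedex : Tm → Prop where
  | beta : ∀ {S t v}, IsValue v → IsRedex (.app (.lam S t) v)
  | betaT : ∀ {t S}, IsRedex (.tapp (.tlam t) S)
  | callcc : ∀ {t}, IsRedex (.callcc t)
  | throw : ∀ {E v}, IsValue v → IsRedex (.throwCtx E v)

/-- `Norm p`: the program `p` evaluates to a value. -/
def Norm (p : Tm) : Prop := ∃ v, IsValue v ∧ Steps p v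

/-- A reducibility candidate of type `S` is a set of closed values of type `S`. -/
def IsCand (S : Ty) (R : Set Tm) : Prop :=
  ∀ v ∈ R, IsValue v ∧ ClosedTm v ∧ HasTy [] [] v S

/-- `CtxOK R E` is the predicate `R ⊨ E`, i.e. `∀ v ∈ R, norm (E[v])`. -/
def CtxOK (R : Set Tm) (E : Ctx) : Prop := ∀ v ∈ R, Norm (plug v E)

/-- `CtxAdm A R E`: `E` is a closed context of type `¬A` with `R ⊨ E`. -/
def CtxAdm (A : Ty) (R : Set Tm) (E : Ctx) : Prop :=
  ClosedCtx E ∧ HasTyCtx [] [] E A ∧ CtxOK R E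

/-- The parametric reducibility candidate `RED_S(ᾱ ↦ R̄)` (call by value),
defined by induction on `S`.  `Ts` are the types of the candidates `Rs`. -/
def RED : Ty → List Ty → List (Set Tm) → Set Tm
  | .var i, _, Rs => Rs.getD i ∅
  | .arrow S1 S2, Ts, Rs =>
      {v0 | IsValue v0 ∧ ClosedTm v0 ∧ HasTy [] [] v0 (subTyList Ts (.arrow S1 S2)) ∧
        ∀ v1 ∈ RED S1 Ts Rs, ∀ E, CtxAdm (subTyList Ts S2) (RED S2 Ts Rs) E →
          Norm (plug (.app v0 v1) E)}
  | .all S, Ts, Rs =>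
      {v | IsValue v ∧ ClosedTm v ∧ HasTy [] [] v (subTyList Ts (.all S)) ∧
        ∀ (U : Ty) (Rc : Set Tm), IsCand U Rc →
          ∀ E, CtxAdm (subTyList (U::Ts) S) (RED S (U::Ts) (Rc::Rs)) E →
            Norm (plug (.tapp v U) E)}

end LambdaFv
namespace LambdaFv

/-- Extension of a de Bruijn environment by a value for index `0`. -/
def extend {α : Type*} (a : α) (f : Nat → α) : Nat → α
  | 0 => a
  | n+1 => f n

/-! ### Substitution calculus for types -/

theorem liftRen_id : liftRen id = id := by
  funext n; cases n <;> rfl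

theorem liftRen_comp (f g : Nat → Nat) : liftRen g ∘ liftRen f = liftRen (g ∘ f) := by
  funext n; cases n <;> rfl

theorem renTy_renTy (S : Ty) : ∀ f g, renTy g (renTy f S) = renTy (g ∘ f) S := by
  induction S with
  | var n => intro f g; rfl
  | arrow a b iha ihb => intro f g; simp [renTy, iha, ihb]
  | all a ih => intro f g; simp [renTy, ih, liftRen_comp]

theorem liftTySub_comp_liftRen (f : Nat → Nat) (τ : Nat → Ty) :
    liftTySub τ ∘ liftRen f = liftTySub (τ ∘ f) := by
  funext n; cases n <;> rfl

theorem subTy_renTy (S : Ty) : ∀ f τ, subTy τ (renTy f S) = subTy (τ ∘ f) S := by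
  induction S with
  | var n => intro f τ; rfl
  | arrow a b iha ihb => intro f τ; simp [renTy, subTy, iha, ihb]
  | all a ih => intro f τ; simp [renTy, subTy, ih, liftTySub_comp_liftRen]

theorem renTy_liftRen_comp_liftTySub (f : Nat → Nat) (σ : Nat → Ty) :
    renTy (liftRen f) ∘ liftTySub σ = liftTySub (renTy f ∘ σ) := by
  funext n
  cases n with
  | zero => rfl
  | succ n => simp only [Function.comp, liftTySub, renTy_renTy]; rfl

theorem renTy_subTy (S : Ty) : ∀ f σ, renTy f (subTy σ S) = subTy (renTy f ∘ σ) S := by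
  induction S with
  | var n => intro f σ; rfl
  | arrow a b iha ihb => intro f σ; simp [renTy, subTy, iha, ihb]
  | all a ih => intro f σ; simp [renTy, subTy, ih, renTy_liftRen_comp_liftTySub]

theorem subTy_liftTySub_comp_liftTySub (σ τ : Nat → Ty) :
    subTy (liftTySub τ) ∘ liftTySub σ = liftTySub (subTy τ ∘ σ) := by
  funext n
  cases n with
  | zero => rfl
  | succ n => simp only [Function.comp, liftTySub, subTy_renTy, renTy_subTy]; rfl

theorem subTy_subTy (S : Ty) : ∀ σ τ, subTy τ (subTy σ S) = subTy (subTy τ ∘ σ) S := by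
  induction S with
  | var n => intro σ τ; rfl
  | arrow a b iha ihb => intro σ τ; simp [subTy, iha, ihb]
  | all a ih => intro σ τ; simp [subTy, ih, subTy_liftTySub_comp_liftTySub]

theorem liftTySub_var : liftTySub Ty.var = Ty.var := by
  funext n; cases n <;> rfl

theorem subTy_var (S : Ty) : subTy Ty.var S = S := by
  induction S with
  | var n => rfl
  | arrow a b iha ihb => simp [subTy, iha, ihb]
  | all a ih => simp [subTy, ih, liftTySub_var]

/-! ### Substitution calculus for terms and contexts -/

mutual
theorem renTm_renTm (fx fk fa gx gk ga : Nat → Nat) : ∀ t,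
    renTm gx gk ga (renTm fx fk fa t) = renTm (gx ∘ fx) (gk ∘ fk) (ga ∘ fa) t
  | .var n => rfl
  | .lam S t => by simp [renTm, renTy_renTy, renTm_renTm _ _ _ _ _ _ t, liftRen_comp]
  | .app a b => by simp [renTm, renTm_renTm _ _ _ _ _ _ a, renTm_renTm _ _ _ _ _ _ b]
  | .tlam t => by simp [renTm, renTm_renTm _ _ _ _ _ _ t, liftRen_comp]
  | .tapp t S => by simp [renTm, renTy_renTy, renTm_renTm _ _ _ _ _ _ t]
  | .callcc t => by simp [renTm, renTm_renTm _ _ _ _ _ _ t, liftRen_comp]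
  | .throwVar k t => by simp [renTm, renTm_renTm _ _ _ _ _ _ t]
  | .throwCtx E t => by
      simp [renTm, renTm_renTm _ _ _ _ _ _ t, renCtx_renCtx _ _ _ _ _ _ E]

theorem renCtx_renCtx (fx fk fa gx gk ga : Nat → Nat) : ∀ E,
    renCtx gx gk ga (renCtx fx fk fa E) = renCtx (gx ∘ fx) (gk ∘ fk) (ga ∘ fa) E
  | .hole => rfl
  | .lamApp S t E => by
      simp [renCtx, renTy_renTy, renTm_renTm _ _ _ _ _ _ t, liftRen_comp,
        renCtx_renCtx _ _ _ _ _ _ E]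
  | .app E t => by simp [renCtx, renTm_renTm _ _ _ _ _ _ t, renCtx_renCtx _ _ _ _ _ _ E]
  | .tapp E S => by simp [renCtx, renTy_renTy, renCtx_renCtx _ _ _ _ _ _ E]
  | .throw E F => by
      simp [renCtx, renCtx_renCtx _ _ _ _ _ _ E, renCtx_renCtx _ _ _ _ _ _ F]
end

theorem liftSubX_comp_liftRen (f : Nat → Nat) (τ : Nat → Tm) :
    liftSubX τ ∘ liftRen f = liftSubX (τ ∘ f) := by
  funext n; cases n <;> rfl

theorem liftSubK_comp_liftRen (f : Nat → Nat) (τ : Nat → Ctx ⊕ Nat) :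
    liftSubK τ ∘ liftRen f = liftSubK (τ ∘ f) := by
  funext n; cases n <;> rfl

theorem shiftSubXk_comp (f : Nat → Nat) (τ : Nat → Tm) :
    shiftSubXk τ ∘ f = shiftSubXk (τ ∘ f) := rfl

theorem shiftSubXa_comp (f : Nat → Nat) (τ : Nat → Tm) :
    shiftSubXa τ ∘ f = shiftSubXa (τ ∘ f) := rfl

theorem shiftSubKx_comp (f : Nat → Nat) (τ : Nat → Ctx ⊕ Nat) :
    shiftSubKx τ ∘ f = shiftSubKx (τ ∘ f) := rfl

theorem shiftSubKa_comp (f : Nat → Nat) (τ : Nat → Ctx ⊕ Nat) :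
    shiftSubKa τ ∘ f = shiftSubKa (τ ∘ f) := rfl

mutual
theorem subTm_renTm (fx fk fa : Nat → Nat) (τx : Nat → Tm) (τk : Nat → Ctx ⊕ Nat)
    (τa : Nat → Ty) : ∀ t,
    subTm τx τk τa (renTm fx fk fa t) = subTm (τx ∘ fx) (τk ∘ fk) (τa ∘ fa) t
  | .var n => rfl
  | .lam S t => by
      simp [renTm, subTm, subTy_renTy, subTm_renTm _ _ _ _ _ _ t, liftSubX_comp_liftRen,
        shiftSubKx_comp]
  | .app a b => by simp [renTm, subTm, subTm_renTm _ _ _ _ _ _ a, subTm_renTm _ _ _ _ _ _ b]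
  | .tlam t => by
      simp [renTm, subTm, subTm_renTm _ _ _ _ _ _ t, shiftSubXa_comp, shiftSubKa_comp,
        liftTySub_comp_liftRen]
  | .tapp t S => by simp [renTm, subTm, subTy_renTy, subTm_renTm _ _ _ _ _ _ t]
  | .callcc t => by
      simp [renTm, subTm, subTm_renTm _ _ _ _ _ _ t, liftSubK_comp_liftRen, shiftSubXk_comp]
  | .throwVar k t => by
      simp only [renTm, subTm, subTm_renTm _ _ _ _ _ _ t, Function.comp]
  | .throwCtx E t => by
      simp [renTm, subTm, subTm_renTm _ _ _ _ _ _ t, subCtx_renCtx _ _ _ _ _ _ E]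

theorem subCtx_renCtx (fx fk fa : Nat → Nat) (τx : Nat → Tm) (τk : Nat → Ctx ⊕ Nat)
    (τa : Nat → Ty) : ∀ E,
    subCtx τx τk τa (renCtx fx fk fa E) = subCtx (τx ∘ fx) (τk ∘ fk) (τa ∘ fa) E
  | .hole => rfl
  | .lamApp S t E => by
      simp [renCtx, subCtx, subTy_renTy, subTm_renTm _ _ _ _ _ _ t, liftSubX_comp_liftRen,
        shiftSubKx_comp, subCtx_renCtx _ _ _ _ _ _ E]
  | .app E t => by
      simp [renCtx, subCtx, subTm_renTm _ _ _ _ _ _ t, subCtx_renCtx _ _ _ _ _ _ E]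
  | .tapp E S => by simp [renCtx, subCtx, subTy_renTy, subCtx_renCtx _ _ _ _ _ _ E]
  | .throw E F => by
      simp [renCtx, subCtx, subCtx_renCtx _ _ _ _ _ _ E, subCtx_renCtx _ _ _ _ _ _ F]
end

/-- Post-composition of a continuation substitution with a renaming. -/
def renSubK (gx gk ga : Nat → Nat) (σ : Nat → Ctx ⊕ Nat) : Nat → Ctx ⊕ Nat := fun n =>
  match σ n with
  | .inl E => .inl (renCtx gx gk ga E)
  | .inr m => .inr (gk m)

theorem renTm_comp_liftSubX (gx gk ga : Nat → Nat) (σ : Nat → Tm) :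
    renTm (liftRen gx) gk ga ∘ liftSubX σ = liftSubX (renTm gx gk ga ∘ σ) := by
  funext n
  cases n with
  | zero => rfl
  | succ n => simp only [Function.comp, liftSubX, renTm_renTm]; rfl

theorem renTm_comp_shiftSubXk (gx gk ga : Nat → Nat) (σ : Nat → Tm) :
    renTm gx (liftRen gk) ga ∘ shiftSubXk σ = shiftSubXk (renTm gx gk ga ∘ σ) := by
  funext n; simp only [Function.comp, shiftSubXk, renTm_renTm]; rfl

theorem renTm_comp_shiftSubXa (gx gk ga : Nat → Nat) (σ : Nat → Tm) :
    renTm gx gk (liftRen ga) ∘ shiftSubXa σ = shiftSubXa (renTm gx gk ga ∘ σ) := by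
  funext n; simp only [Function.comp, shiftSubXa, renTm_renTm]; rfl

theorem renSubK_liftSubK (gx gk ga : Nat → Nat) (σ : Nat → Ctx ⊕ Nat) :
    renSubK gx (liftRen gk) ga (liftSubK σ) = liftSubK (renSubK gx gk ga σ) := by
  funext n
  cases n with
  | zero => rfl
  | succ n =>
    cases h : σ n with
    | inl E => simp only [renSubK, liftSubK, h, renCtx_renCtx]; rfl
    | inr m => simp only [renSubK, liftSubK, h]; rfl

theorem renSubK_shiftSubKx (gx gk ga : Nat → Nat) (σ : Nat → Ctx ⊕ Nat) :
    renSubK (liftRen gx) gk ga (shiftSubKx σ) = shiftSubKx (renSubK gx gk ga σ) := by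
  funext n
  cases h : σ n with
  | inl E => simp only [renSubK, shiftSubKx, mapKEnt, h, renCtx_renCtx]; rfl
  | inr m => simp only [renSubK, shiftSubKx, mapKEnt, h]

theorem renSubK_shiftSubKa (gx gk ga : Nat → Nat) (σ : Nat → Ctx ⊕ Nat) :
    renSubK gx gk (liftRen ga) (shiftSubKa σ) = shiftSubKa (renSubK gx gk ga σ) := by
  funext n
  cases h : σ n with
  | inl E => simp only [renSubK, shiftSubKa, mapKEnt, h, renCtx_renCtx]; rfl
  | inr m => simp only [renSubK, shiftSubKa, mapKEnt, h]

mutual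
theorem renTm_subTm (gx gk ga : Nat → Nat) (σx : Nat → Tm) (σk : Nat → Ctx ⊕ Nat)
    (σa : Nat → Ty) : ∀ t, renTm gx gk ga (subTm σx σk σa t) =
      subTm (renTm gx gk ga ∘ σx) (renSubK gx gk ga σk) (renTy ga ∘ σa) t
  | .var n => rfl
  | .lam S t => by
      simp [renTm, subTm, renTy_subTy, renTm_subTm _ _ _ _ _ _ t, renTm_comp_liftSubX,
        renSubK_shiftSubKx]
  | .app a b => by simp [renTm, subTm, renTm_subTm _ _ _ _ _ _ a, renTm_subTm _ _ _ _ _ _ b]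
  | .tlam t => by
      simp [renTm, subTm, renTm_subTm _ _ _ _ _ _ t, renTm_comp_shiftSubXa,
        renSubK_shiftSubKa, renTy_liftRen_comp_liftTySub]
  | .tapp t S => by simp [renTm, subTm, renTy_subTy, renTm_subTm _ _ _ _ _ _ t]
  | .callcc t => by
      simp [renTm, subTm, renTm_subTm _ _ _ _ _ _ t, renTm_comp_shiftSubXk, renSubK_liftSubK]
  | .throwVar k t => by
      cases h : σk k <;> simp [renTm, subTm, renSubK, h, renTm_subTm _ _ _ _ _ _ t]
  | .throwCtx E t => by
      simp [renTm, subTm, renTm_subTm _ _ _ _ _ _ t, renCtx_subCtx _ _ _ _ _ _ E]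

theorem renCtx_subCtx (gx gk ga : Nat → Nat) (σx : Nat → Tm) (σk : Nat → Ctx ⊕ Nat)
    (σa : Nat → Ty) : ∀ E, renCtx gx gk ga (subCtx σx σk σa E) =
      subCtx (renTm gx gk ga ∘ σx) (renSubK gx gk ga σk) (renTy ga ∘ σa) E
  | .hole => rfl
  | .lamApp S t E => by
      simp [renCtx, subCtx, renTy_subTy, renTm_subTm _ _ _ _ _ _ t, renTm_comp_liftSubX,
        renSubK_shiftSubKx, renCtx_subCtx _ _ _ _ _ _ E]
  | .app E t => by
      simp [renCtx, subCtx, renTm_subTm _ _ _ _ _ _ t, renCtx_subCtx _ _ _ _ _ _ E]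
  | .tapp E S => by simp [renCtx, subCtx, renTy_subTy, renCtx_subCtx _ _ _ _ _ _ E]
  | .throw E F => by
      simp [renCtx, subCtx, renCtx_subCtx _ _ _ _ _ _ E, renCtx_subCtx _ _ _ _ _ _ F]
end

/-- Post-composition of a continuation substitution with a substitution. -/
def compSubK (τx : Nat → Tm) (τk : Nat → Ctx ⊕ Nat) (τa : Nat → Ty)
    (σ : Nat → Ctx ⊕ Nat) : Nat → Ctx ⊕ Nat := fun n =>
  match σ n with
  | .inl E => .inl (subCtx τx τk τa E)
  | .inr m => τk m

theorem renSubK_k (σ : Nat → Ctx ⊕ Nat) :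
    renSubK id Nat.succ id σ = liftSubK σ ∘ Nat.succ := by
  funext n; cases h : σ n <;> simp [renSubK, liftSubK, h]

theorem renSubK_x (σ : Nat → Ctx ⊕ Nat) : renSubK Nat.succ id id σ = shiftSubKx σ := by
  funext n; cases h : σ n <;> simp [renSubK, shiftSubKx, mapKEnt, h]

theorem renSubK_a (σ : Nat → Ctx ⊕ Nat) : renSubK id id Nat.succ σ = shiftSubKa σ := by
  funext n; cases h : σ n <;> simp [renSubK, shiftSubKa, mapKEnt, h]

theorem renTy_id (S : Ty) : renTy id S = S := by
  induction S with
  | var n => rfl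
  | arrow a b iha ihb => simp [renTy, iha, ihb]
  | all a ih => simp [renTy, ih, liftRen_id]

theorem renTy_id_comp (σ : Nat → Ty) : renTy id ∘ σ = σ := by
  funext n; exact renTy_id _

section Commutation

variable (τx : Nat → Tm) (τk : Nat → Ctx ⊕ Nat) (τa : Nat → Ty)

theorem subTm_weaken_x (t : Tm) :
    subTm (liftSubX τx) (shiftSubKx τk) τa (renTm Nat.succ id id t) =
      renTm Nat.succ id id (subTm τx τk τa t) := by
  rw [subTm_renTm, renTm_subTm, renSubK_x, renTy_id_comp]; rfl

theorem subCtx_weaken_x (E : Ctx) :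
    subCtx (liftSubX τx) (shiftSubKx τk) τa (renCtx Nat.succ id id E) =
      renCtx Nat.succ id id (subCtx τx τk τa E) := by
  rw [subCtx_renCtx, renCtx_subCtx, renSubK_x, renTy_id_comp]; rfl

theorem subTm_weaken_k (t : Tm) :
    subTm (shiftSubXk τx) (liftSubK τk) τa (renTm id Nat.succ id t) =
      renTm id Nat.succ id (subTm τx τk τa t) := by
  rw [subTm_renTm, renTm_subTm, renSubK_k, renTy_id_comp]; rfl

theorem subCtx_weaken_k (E : Ctx) :
    subCtx (shiftSubXk τx) (liftSubK τk) τa (renCtx id Nat.succ id E) =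
      renCtx id Nat.succ id (subCtx τx τk τa E) := by
  rw [subCtx_renCtx, renCtx_subCtx, renSubK_k, renTy_id_comp]; rfl

theorem subTm_weaken_a (t : Tm) :
    subTm (shiftSubXa τx) (shiftSubKa τk) (liftTySub τa) (renTm id id Nat.succ t) =
      renTm id id Nat.succ (subTm τx τk τa t) := by
  rw [subTm_renTm, renTm_subTm, renSubK_a]; rfl

theorem subCtx_weaken_a (E : Ctx) :
    subCtx (shiftSubXa τx) (shiftSubKa τk) (liftTySub τa) (renCtx id id Nat.succ E) =
      renCtx id id Nat.succ (subCtx τx τk τa E) := by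
  rw [subCtx_renCtx, renCtx_subCtx, renSubK_a]; rfl

theorem subTm_comp_liftSubX (σ : Nat → Tm) :
    subTm (liftSubX τx) (shiftSubKx τk) τa ∘ liftSubX σ =
      liftSubX (subTm τx τk τa ∘ σ) := by
  funext n
  cases n with
  | zero => rfl
  | succ n => exact subTm_weaken_x _ _ _ _

theorem subTm_comp_shiftSubXk (σ : Nat → Tm) :
    subTm (shiftSubXk τx) (liftSubK τk) τa ∘ shiftSubXk σ =
      shiftSubXk (subTm τx τk τa ∘ σ) := by
  funext n; exact subTm_weaken_k _ _ _ _

theorem subTm_comp_shiftSubXa (σ : Nat → Tm) :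
    subTm (shiftSubXa τx) (shiftSubKa τk) (liftTySub τa) ∘ shiftSubXa σ =
      shiftSubXa (subTm τx τk τa ∘ σ) := by
  funext n; exact subTm_weaken_a _ _ _ _

theorem compSubK_shiftSubKx (σ : Nat → Ctx ⊕ Nat) :
    compSubK (liftSubX τx) (shiftSubKx τk) τa (shiftSubKx σ) =
      shiftSubKx (compSubK τx τk τa σ) := by
  funext n
  cases h : σ n with
  | inl E => simp [compSubK, shiftSubKx, mapKEnt, h]; exact subCtx_weaken_x _ _ _ _
  | inr m => simp [compSubK, shiftSubKx, mapKEnt, h]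

theorem compSubK_shiftSubKa (σ : Nat → Ctx ⊕ Nat) :
    compSubK (shiftSubXa τx) (shiftSubKa τk) (liftTySub τa) (shiftSubKa σ) =
      shiftSubKa (compSubK τx τk τa σ) := by
  funext n
  cases h : σ n with
  | inl E => simp [compSubK, shiftSubKa, mapKEnt, h, subCtx_weaken_a]
  | inr m => simp [compSubK, shiftSubKa, mapKEnt, h]

theorem compSubK_liftSubK (σ : Nat → Ctx ⊕ Nat) :
    compSubK (shiftSubXk τx) (liftSubK τk) τa (liftSubK σ) =
      liftSubK (compSubK τx τk τa σ) := by
  funext n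
  cases n with
  | zero => rfl
  | succ n =>
    cases h : σ n with
    | inl E => simp [compSubK, liftSubK, h, subCtx_weaken_k]
    | inr m => simp [compSubK, liftSubK, h]

end Commutation

mutual
theorem subTm_subTm (σx : Nat → Tm) (σk : Nat → Ctx ⊕ Nat) (σa : Nat → Ty)
    (τx : Nat → Tm) (τk : Nat → Ctx ⊕ Nat) (τa : Nat → Ty) : ∀ t,
    subTm τx τk τa (subTm σx σk σa t) =
      subTm (subTm τx τk τa ∘ σx) (compSubK τx τk τa σk) (subTy τa ∘ σa) t
  | .var n => rfl
  | .lam S t => by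
      simp [subTm, subTy_subTy, subTm_subTm _ _ _ _ _ _ t, subTm_comp_liftSubX,
        compSubK_shiftSubKx]
  | .app a b => by simp [subTm, subTm_subTm _ _ _ _ _ _ a, subTm_subTm _ _ _ _ _ _ b]
  | .tlam t => by
      simp [subTm, subTm_subTm _ _ _ _ _ _ t, subTm_comp_shiftSubXa,
        compSubK_shiftSubKa, subTy_liftTySub_comp_liftTySub]
  | .tapp t S => by simp [subTm, subTy_subTy, subTm_subTm _ _ _ _ _ _ t]
  | .callcc t => by
      simp [subTm, subTm_subTm _ _ _ _ _ _ t, subTm_comp_shiftSubXk, compSubK_liftSubK]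
  | .throwVar k t => by
      cases h : σk k <;> simp [subTm, compSubK, h, subTm_subTm _ _ _ _ _ _ t]
  | .throwCtx E t => by
      simp [subTm, subTm_subTm _ _ _ _ _ _ t, subCtx_subCtx _ _ _ _ _ _ E]

theorem subCtx_subCtx (σx : Nat → Tm) (σk : Nat → Ctx ⊕ Nat) (σa : Nat → Ty)
    (τx : Nat → Tm) (τk : Nat → Ctx ⊕ Nat) (τa : Nat → Ty) : ∀ E,
    subCtx τx τk τa (subCtx σx σk σa E) =
      subCtx (subTm τx τk τa ∘ σx) (compSubK τx τk τa σk) (subTy τa ∘ σa) E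
  | .hole => rfl
  | .lamApp S t E => by
      simp [subCtx, subTy_subTy, subTm_subTm _ _ _ _ _ _ t, subTm_comp_liftSubX,
        compSubK_shiftSubKx, subCtx_subCtx _ _ _ _ _ _ E]
  | .app E t => by
      simp [subCtx, subTm_subTm _ _ _ _ _ _ t, subCtx_subCtx _ _ _ _ _ _ E]
  | .tapp E S => by simp [subCtx, subTy_subTy, subCtx_subCtx _ _ _ _ _ _ E]
  | .throw E F => by
      simp [subCtx, subCtx_subCtx _ _ _ _ _ _ E, subCtx_subCtx _ _ _ _ _ _ F]
end

theorem liftSubX_var : liftSubX Tm.var = Tm.var := by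
  funext n; cases n <;> rfl

theorem liftSubK_inr : liftSubK Sum.inr = Sum.inr := by
  funext n; cases n <;> rfl

theorem shiftSubXk_var : shiftSubXk Tm.var = Tm.var := rfl

theorem shiftSubXa_var : shiftSubXa Tm.var = Tm.var := rfl

theorem shiftSubKx_inr : shiftSubKx Sum.inr = Sum.inr := rfl

theorem shiftSubKa_inr : shiftSubKa Sum.inr = Sum.inr := rfl

mutual
theorem subTm_id : ∀ t, subTm Tm.var Sum.inr Ty.var t = t
  | .var n => rfl
  | .lam S t => by simp [subTm, subTy_var, liftSubX_var, shiftSubKx_inr, subTm_id t]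
  | .app a b => by simp [subTm, subTm_id a, subTm_id b]
  | .tlam t => by
      simp [subTm, shiftSubXa_var, shiftSubKa_inr, liftTySub_var, subTm_id t]
  | .tapp t S => by simp [subTm, subTy_var, subTm_id t]
  | .callcc t => by simp [subTm, shiftSubXk_var, liftSubK_inr, subTm_id t]
  | .throwVar k t => by simp [subTm, subTm_id t]
  | .throwCtx E t => by simp [subTm, subTm_id t, subCtx_id E]

theorem subCtx_id : ∀ E, subCtx Tm.var Sum.inr Ty.var E = E
  | .hole => rfl
  | .lamApp S t E => by
      simp [subCtx, subTy_var, liftSubX_var, shiftSubKx_inr, subTm_id t, subCtx_id E]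
  | .app E t => by simp [subCtx, subTm_id t, subCtx_id E]
  | .tapp E S => by simp [subCtx, subTy_var, subCtx_id E]
  | .throw E F => by simp [subCtx, subCtx_id E, subCtx_id F]
end

section Instantiation

variable (σx : Nat → Tm) (σk : Nat → Ctx ⊕ Nat) (σa : Nat → Ty)

theorem sub0X_subTm (v t : Tm) :
    sub0X v (subTm (liftSubX σx) (shiftSubKx σk) σa t) = subTm (extend v σx) σk σa t := by
  rw [sub0X, subTm_subTm]
  congr 1
  · funext n
    cases n with
    | zero => rfl
    | succ n => exact (subTm_renTm _ _ _ _ _ _ _).trans (subTm_id _)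
  · funext n
    cases h : σk n with
    | inl E =>
      simp only [compSubK, shiftSubKx, mapKEnt, h]
      exact congrArg Sum.inl ((subCtx_renCtx _ _ _ _ _ _ _).trans (subCtx_id _))
    | inr m => simp only [compSubK, shiftSubKx, mapKEnt, h]
  · funext n; exact subTy_var _

theorem sub0K_subTm (E : Ctx) (t : Tm) :
    sub0K E (subTm (shiftSubXk σx) (liftSubK σk) σa t) =
      subTm σx (extend (.inl E) σk) σa t := by
  rw [sub0K, subTm_subTm]
  congr 1
  · funext n
    exact (subTm_renTm _ _ _ _ _ _ _).trans (subTm_id _)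
  · funext n
    cases n with
    | zero => rfl
    | succ n =>
      cases h : σk n with
      | inl E =>
        simp only [compSubK, liftSubK, extend, h]
        exact congrArg Sum.inl ((subCtx_renCtx _ _ _ _ _ _ _).trans (subCtx_id _))
      | inr m => simp only [compSubK, liftSubK, extend, h]
  · funext n; exact subTy_var _

theorem sub0A_subTm (U : Ty) (t : Tm) :
    sub0A U (subTm (shiftSubXa σx) (shiftSubKa σk) (liftTySub σa) t) =
      subTm σx σk (extend U σa) t := by
  rw [sub0A, subTm_subTm]
  congr 1
  · funext n
    exact (subTm_renTm _ _ _ _ _ _ _).trans (subTm_id _)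
  · funext n
    cases h : σk n with
    | inl E =>
      simp only [compSubK, shiftSubKa, mapKEnt, h]
      exact congrArg Sum.inl ((subCtx_renCtx _ _ _ _ _ _ _).trans (subCtx_id _))
    | inr m => simp only [compSubK, shiftSubKa, mapKEnt, h]
  · funext n
    cases n with
    | zero => rfl
    | succ n => exact (subTy_renTy _ _ _).trans (subTy_var _)

end Instantiation

/-! ### Untyped reducibility

Candidates are arbitrary sets of values, with no typing or closedness constraint.  Every
well-typed term and context, plain or not, is reducible in this sense. -/

/-- The untyped reducibility predicate for an assignment `ρ` of sets of values. -/
def URed : Ty → (Nat → Set Tm) → Set Tm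
  | .var i, ρ => ρ i
  | .arrow S T, ρ => {v | ∃ A b, v = .lam A b ∧ ∀ w ∈ URed S ρ, ∀ E, CtxOK (URed T ρ) E →
      Norm (plug (sub0X w b) E)}
  | .all S, ρ => {v | ∃ b, v = .tlam b ∧ ∀ (U : Ty) (R : Set Tm), (∀ w ∈ R, IsValue w) →
      ∀ E, CtxOK (URed S (extend R ρ)) E → Norm (plug (sub0A U b) E)}

theorem extend_comp_liftRen {α : Type*} (a : α) (ρ : Nat → α) (f : Nat → Nat) :
    extend a ρ ∘ liftRen f = extend a (ρ ∘ f) := by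
  funext n; cases n <;> rfl

theorem URed_renTy (S : Ty) : ∀ f ρ, URed (renTy f S) ρ = URed S (ρ ∘ f) := by
  induction S with
  | var n => intro f ρ; rfl
  | arrow a b iha ihb => intro f ρ; simp only [renTy, URed, iha, ihb]
  | all a ih => intro f ρ; simp only [renTy, URed, ih, extend_comp_liftRen]

theorem URed_liftTySub (R : Set Tm) (ρ : Nat → Set Tm) (σ : Nat → Ty) :
    (fun n => URed (liftTySub σ n) (extend R ρ)) = extend R (fun n => URed (σ n) ρ) := by
  funext n
  cases n with
  | zero => rfl
  | succ n => exact URed_renTy _ _ _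

theorem URed_subTy (S : Ty) :
    ∀ σ ρ, URed (subTy σ S) ρ = URed S (fun n => URed (σ n) ρ) := by
  induction S with
  | var n => intro σ ρ; rfl
  | arrow a b iha ihb => intro σ ρ; simp only [subTy, URed, iha, ihb]
  | all a ih => intro σ ρ; simp only [subTy, URed, ih, URed_liftTySub]

theorem URed_subTy0 (T S : Ty) (ρ : Nat → Set Tm) :
    URed (subTy0 T S) ρ = URed S (extend (URed T ρ) ρ) := by
  rw [subTy0, URed_subTy]
  congr 1
  funext n; cases n <;> rfl

theorem isValue_of_mem_URed {ρ : Nat → Set Tm} (hρ : ∀ i, ∀ v ∈ ρ i, IsValue v) :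
    ∀ (S : Ty), ∀ v ∈ URed S ρ, IsValue v
  | .var i, v, hv => hρ i v hv
  | .arrow _ _, _, ⟨_, _, h, _⟩ => h ▸ IsValue.lam
  | .all _, _, ⟨_, h, _⟩ => h ▸ IsValue.tlam

theorem Norm.of_step {p q : Tm} (h : Step p q) : Norm q → Norm p
  | ⟨v, hv, hs⟩ => ⟨v, hv, Relation.ReflTransGen.head h hs⟩

theorem Norm.of_isValue {v : Tm} (h : IsValue v) : Norm v :=
  ⟨v, h, Relation.ReflTransGen.refl⟩

/-- The substitutions `σx`, `σk` realize the contexts `Γ`, `Δ` with respect to `ρ`. -/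
structure Realizes (ρ : Nat → Set Tm) (Γ Δ : List Ty) (σx : Nat → Tm)
    (σk : Nat → Ctx ⊕ Nat) : Prop where
  cand : ∀ i, ∀ v ∈ ρ i, IsValue v
  val : ∀ i S, Γ[i]? = some S → σx i ∈ URed S ρ
  ctx : ∀ i S, Δ[i]? = some S → ∃ E, σk i = .inl E ∧ CtxOK (URed S ρ) E

namespace Realizes

variable {ρ : Nat → Set Tm} {Γ Δ : List Ty} {σx : Nat → Tm} {σk : Nat → Ctx ⊕ Nat}

theorem extendVal (h : Realizes ρ Γ Δ σx σk) {v : Tm} {S : Ty} (hv : v ∈ URed S ρ) :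
    Realizes ρ (S :: Γ) Δ (extend v σx) σk where
  cand := h.cand
  val i T hi := by
    cases i with
    | zero => obtain rfl : S = T := by simpa using hi
              exact hv
    | succ i => exact h.val i T (by simpa using hi)
  ctx := h.ctx

theorem extendCtx (h : Realizes ρ Γ Δ σx σk) {E : Ctx} {S : Ty}
    (hE : CtxOK (URed S ρ) E) : Realizes ρ Γ (S :: Δ) σx (extend (.inl E) σk) where
  cand := h.cand
  val := h.val
  ctx i T hi := by
    cases i with
    | zero => obtain rfl : S = T := by simpa using hi
              exact ⟨E, rfl, hE⟩
    | succ i => exact h.ctx i T (by simpa using hi)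

theorem extendCand (h : Realizes ρ Γ Δ σx σk) {R : Set Tm} (hR : ∀ v ∈ R, IsValue v) :
    Realizes (extend R ρ) (Γ.map (renTy Nat.succ)) (Δ.map (renTy Nat.succ)) σx σk where
  cand i := by
    cases i with
    | zero => exact hR
    | succ i => exact h.cand i
  val i T hi := by
    obtain ⟨S, hS, rfl⟩ : ∃ S, Γ[i]? = some S ∧ renTy Nat.succ S = T := by simpa using hi
    rw [URed_renTy]
    exact h.val i S hS
  ctx i T hi := by
    obtain ⟨S, hS, rfl⟩ : ∃ S, Δ[i]? = some S ∧ renTy Nat.succ S = T := by simpa using hi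
    rw [URed_renTy]
    exact h.ctx i S hS

end Realizes

mutual
/-- Well-typed terms are reducible. -/
theorem norm_plug_subTm {Γ Δ : List Ty} {t : Tm} {S : Ty} (ht : HasTy Γ Δ t S)
    (ρ : Nat → Set Tm) (σx : Nat → Tm) (σk : Nat → Ctx ⊕ Nat) (σa : Nat → Ty)
    (h : Realizes ρ Γ Δ σx σk) (E : Ctx) (hE : CtxOK (URed S ρ) E) :
    Norm (plug (subTm σx σk σa t) E) := by
  match ht with
  | .var hx => exact hE _ (h.val _ _ hx)
  | .lam hb =>
    refine hE _ ⟨_, _, rfl, fun w hw F hF => ?_⟩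
    rw [sub0X_subTm]
    exact norm_plug_subTm hb ρ _ _ _ (h.extendVal hw) F hF
  | .app (t0 := t0) (t1 := t1) h0 h1 =>
    refine norm_plug_subTm h0 ρ σx σk σa h (.app E (subTm σx σk σa t1)) ?_
    rintro _ ⟨A, b, rfl, hb⟩
    refine norm_plug_subTm h1 ρ σx σk σa h (.lamApp A b E) fun w hw => ?_
    exact .of_step (.beta (isValue_of_mem_URed h.cand _ w hw)) (hb w hw E hE)
  | .tlam hb =>
    refine hE _ ⟨_, rfl, fun U R hR F hF => ?_⟩
    rw [sub0A_subTm]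
    exact norm_plug_subTm hb _ _ _ _ (h.extendCand hR) F hF
  | .tapp (S := S) (T := T) ht0 =>
    refine norm_plug_subTm ht0 ρ σx σk σa h (.tapp E (subTy σa T)) ?_
    rintro _ ⟨b, rfl, hb⟩
    rw [URed_subTy0] at hE
    exact .of_step .betaT (hb _ _ (isValue_of_mem_URed h.cand T) E hE)
  | .callcc hb =>
    refine .of_step .callcc ?_
    rw [sub0K_subTm]
    exact norm_plug_subTm hb ρ _ _ _ (h.extendCtx hE) E hE
  | .throwVar (S := U) hk ht0 =>
    obtain ⟨F, hF, hok⟩ := h.ctx _ _ hk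
    simp only [subTm, hF]
    refine norm_plug_subTm ht0 ρ σx σk σa h (.throw F E) fun w hw => ?_
    exact .of_step (.throw (isValue_of_mem_URed h.cand _ w hw)) (hok w hw)
  | .throwCtx (E := F) hF ht0 =>
    refine norm_plug_subTm ht0 ρ σx σk σa h (.throw (subCtx σx σk σa F) E) fun w hw => ?_
    exact .of_step (.throw (isValue_of_mem_URed h.cand _ w hw))
      (ctxOK_subCtx hF ρ σx σk σa h w hw)
termination_by structural ht

/-- Well-typed contexts are reducible. -/
theorem ctxOK_subCtx {Γ Δ : List Ty} {E : Ctx} {S : Ty} (hE : HasTyCtx Γ Δ E S)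
    (ρ : Nat → Set Tm) (σx : Nat → Tm) (σk : Nat → Ctx ⊕ Nat) (σa : Nat → Ty)
    (h : Realizes ρ Γ Δ σx σk) : CtxOK (URed S ρ) (subCtx σx σk σa E) := by
  match hE with
  | .hole => exact fun v hv => .of_isValue (isValue_of_mem_URed h.cand _ v hv)
  | .lamApp (E := F) ht hF =>
    intro w hw
    refine norm_plug_subTm ht ρ σx σk σa h (.app (subCtx σx σk σa F) w) ?_
    rintro _ ⟨A, b, rfl, hb⟩
    exact .of_step (.beta (isValue_of_mem_URed h.cand _ w hw))
      (hb w hw _ (ctxOK_subCtx hF ρ σx σk σa h))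
  | .app (E := F) ht hF =>
    rintro _ ⟨A, b, rfl, hb⟩
    refine norm_plug_subTm ht ρ σx σk σa h (.lamApp A b (subCtx σx σk σa F)) fun w hw => ?_
    exact .of_step (.beta (isValue_of_mem_URed h.cand _ w hw))
      (hb w hw _ (ctxOK_subCtx hF ρ σx σk σa h))
  | .tapp (T := T) hF =>
    rintro _ ⟨b, rfl, hb⟩
    have hok := ctxOK_subCtx hF ρ σx σk σa h
    rw [URed_subTy0] at hok
    exact .of_step .betaT (hb _ _ (isValue_of_mem_URed h.cand T) _ hok)
  | .throw hF _ =>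
    intro w hw
    exact .of_step (.throw (isValue_of_mem_URed h.cand _ w hw))
      (ctxOK_subCtx hF ρ σx σk σa h w hw)
termination_by structural hE
end

theorem realizes_nil {ρ : Nat → Set Tm} (hρ : ∀ i, ∀ v ∈ ρ i, IsValue v) (σx : Nat → Tm)
    (σk : Nat → Ctx ⊕ Nat) : Realizes ρ [] [] σx σk where
  cand := hρ
  val := by simp
  ctx := by simp

/-- Values typable in the empty contexts are reducible. -/
theorem mem_URed_of_hasTy {v : Tm} {S : Ty} (hv : IsValue v) (ht : HasTy [] [] v S)
    {ρ : Nat → Set Tm} (hρ : ∀ i, ∀ v ∈ ρ i, IsValue v) : v ∈ URed S ρ := by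
  have hr := realizes_nil hρ Tm.var Sum.inr
  cases hv with
  | lam =>
    cases ht with
    | lam hb =>
      refine ⟨_, _, rfl, fun w hw E hE => ?_⟩
      have h := norm_plug_subTm hb ρ _ _ Ty.var (hr.extendVal hw) E hE
      rwa [← sub0X_subTm, liftSubX_var, shiftSubKx_inr, subTm_id] at h
  | tlam =>
    cases ht with
    | tlam hb =>
      refine ⟨_, rfl, fun U R hR E hE => ?_⟩
      have h := norm_plug_subTm hb _ _ _ (extend U Ty.var) (hr.extendCand hR) E hE
      rwa [← sub0A_subTm, shiftSubXa_var, shiftSubKa_inr, liftTySub_var, subTm_id] at h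

/-- Contexts typable in the empty contexts are reducible. -/
theorem ctxOK_of_hasTyCtx {E : Ctx} {S : Ty} (hE : HasTyCtx [] [] E S)
    {ρ : Nat → Set Tm} (hρ : ∀ i, ∀ v ∈ ρ i, IsValue v) : CtxOK (URed S ρ) E := by
  simpa only [subCtx_id] using
    ctxOK_subCtx hE ρ _ _ Ty.var (realizes_nil hρ Tm.var Sum.inr)

/-- **Main lemma for call-by-value `λFv`** (Lemma 2).
Let `t` be a plain term with `Γ;Δ ⊢ t : S` where `Γ = x₁:T₁,…,xₙ:Tₙ` and
`Δ = k₁:¬U₁,…,k_m:¬U_m`; let all free type variables of `S`, `Γ`, `Δ` be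
among `α₁,…,α_p` (de Bruijn: `< Vs.length`); let `V̄` be `p` types and `R̄`
reducibility candidates with `Rᵢ ∈ RC(Vᵢ)`; let `v̄` be closed values with
`⊢ vᵢ : Tᵢ[ᾱ:=V̄]` and `vᵢ ∈ RED_{Tᵢ}(ᾱ↦R̄)`; let `Ē` be closed contexts with
`⊢ Eᵢ : ¬Uᵢ` and `RED_{Uᵢ}(ᾱ↦R̄) ⊨ Eᵢ`; and let `E` be a closed context with
`⊢ E : ¬S` and `RED_S(ᾱ↦R̄) ⊨ E`.  Then
`norm (E[t[ᾱ:=V̄][x̄:=v̄][k̄:=⌈Ē⌉]])` holds. -/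
theorem main_lemma_cbv
    (Γ Δ : List Ty) (t : Tm) (S : Ty)
    (Vs : List Ty) (Rs : List (Set Tm)) (vs : List Tm) (Es : List Ctx) (E : Ctx)
    (hplain : Plain t)
    (hty : HasTy Γ Δ t S)
    (hscS : ScopedTy Vs.length S)
    (hscΓ : ∀ T ∈ Γ, ScopedTy Vs.length T)
    (hscΔ : ∀ U ∈ Δ, ScopedTy Vs.length U)
    (hlenR : Vs.length = Rs.length)
    (hcand : ∀ i < Vs.length, IsCand (Vs.getD i (.var 0)) (Rs.getD i ∅))
    (hlenv : vs.length = Γ.length)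
    (hvals : ∀ i < Γ.length,
      IsValue (vs.getD i (.var 0)) ∧ ClosedTm (vs.getD i (.var 0)) ∧
      HasTy [] [] (vs.getD i (.var 0)) (subTyList Vs (Γ.getD i (.var 0))) ∧
      vs.getD i (.var 0) ∈ RED (Γ.getD i (.var 0)) Vs Rs)
    (hlenE : Es.length = Δ.length)
    (hctxs : ∀ i < Δ.length,
      ClosedCtx (Es.getD i .hole) ∧
      HasTyCtx [] [] (Es.getD i .hole) (Δ.getD i (.var 0)) ∧
      CtxOK (RED (Δ.getD i (.var 0)) Vs Rs) (Es.getD i .hole))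
    (hE : ClosedCtx E ∧ HasTyCtx [] [] E S ∧ CtxOK (RED S Vs Rs) E) :
    Norm (plug (msub Vs vs Es t) E) := by
  have h0 : ∀ i, ∀ v ∈ (fun _ : Nat => (∅ : Set Tm)) i, IsValue v := by simp
  let ρ : Nat → Set Tm := fun n => URed (Vs.getD n (.var n)) fun _ => ∅
  have hρ : ∀ i, ∀ v ∈ ρ i, IsValue v := fun i => isValue_of_mem_URed h0 _
  refine norm_plug_subTm hty ρ _ _ _ ⟨hρ, fun i T hi => ?_, fun i U hi => ?_⟩ E
    (ctxOK_of_hasTyCtx hE.2.1 hρ)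
  · obtain ⟨hlt, rfl⟩ := List.getElem?_eq_some_iff.mp hi
    obtain ⟨hval, -, hvty, -⟩ := hvals i hlt
    have hmem := mem_URed_of_hasTy hval hvty h0
    rw [subTyList, URed_subTy] at hmem
    simpa [ρ, List.getD_eq_getElem?_getD, hlt, hlenv] using hmem
  · obtain ⟨hlt, rfl⟩ := List.getElem?_eq_some_iff.mp hi
    have hlt' : i < Es.length := hlenE ▸ hlt
    have hok := ctxOK_of_hasTyCtx (hctxs i hlt).2.1 hρ
    refine ⟨Es[i], by simp [hlt'], ?_⟩
    simpa [List.getD_eq_getElem?_getD, hlt, hlt'] using hok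

end LambdaFv
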